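/- arXiv:2204.00905 — 2 statements merged into one kernel-verified Lean document; each statement's English description precedes it below -/
import Mathlib

section
/- Let R be a finite commutative Frobenius ring with |R| = q^ω, and C a linear code of length n over R. Then dim(C) + dim(C^⊥) = nω, where dim(E) := log_q(|E|). -/
/-- The dual code of a linear code `C ⊆ Rⁿ` with respect to the standard inner product. -/
def dualCode {R : Type*} [CommRing R] {n : ℕ} (C : Submodule R (Fin n → R)) :
    Submodule R (Fin n → R) where
  carrier := {u | ∀ c ∈ C, ∑ i, u i * c i = 0}
  zero_mem' := by intro c hc; simp
  add_mem' := by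
    intro a b ha hb c hc
    have := ha c hc
    have := hb c hc
    simp only [Pi.add_apply, add_mul, Finset.sum_add_distrib, *, add_zero]
  smul_mem' := by
    intro r a ha c hc
    have h := ha c hc
    simp only [Pi.smul_apply, smul_eq_mul, mul_assoc, ← Finset.mul_sum, h, mul_zero]

/-- The order of a finite module is the product of the orders of a submodule and its quotient. -/
theorem Submodule.natCard_eq_mul_quotient {R M : Type*} [CommRing R]
    [AddCommGroup M] [Module R M] (N : Submodule R M) :
    Nat.card M = Nat.card N * Nat.card (M ⧸ N) := by
  rw [mul_comm]
  exact AddSubgroup.card_eq_card_quotient_mul_card_addSubgroup N.toAddSubgroup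

/-- A simple module over a self-injective commutative ring has at most as many functionals
as elements. -/
theorem IsSimpleModule.natCard_dual_le {R : Type*} [CommRing R] (hR : Module.Injective R R)
    {S : Type*} [AddCommGroup S] [Module R S] [IsSimpleModule R S] [Finite S] :
    Nat.card (S →ₗ[R] R) ≤ Nat.card S := by
  by_cases h : ∃ f : S →ₗ[R] R, f ≠ 0
  · obtain ⟨f, hf⟩ := h
    have hinj : Function.Injective f := f.injective_or_eq_zero.resolve_right hf
    have hmul (g : S →ₗ[R] R) : ∃ r : R, ∀ x, g x = r * f x := by
      obtain ⟨h, hh⟩ := (Module.Baer.of_injective hR).extension_property f hinj g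
      refine ⟨h 1, fun x => ?_⟩
      rw [← hh, LinearMap.comp_apply, mul_comm, ← smul_eq_mul, ← map_smul, smul_eq_mul, mul_one]
    choose r hr using hmul
    have : Nontrivial S := IsSimpleModule.nontrivial R S
    obtain ⟨x, hx⟩ := exists_ne (0 : S)
    refine Nat.card_le_card_of_injective (fun g => r g • x) fun g g' hgg' => ?_
    have hgx : g x = g' x := by
      rw [hr g, hr g', ← smul_eq_mul, ← smul_eq_mul, ← map_smul, ← map_smul]
      exact congrArg f hgg'
    ext y
    obtain ⟨a, rfl⟩ := IsSimpleModule.toSpanSingleton_surjective R hx y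
    simp [hgx]
  · push Not at h
    have : Subsingleton (S →ₗ[R] R) := ⟨fun f g => (h f).trans (h g).symm⟩
    exact (Finite.card_le_one_iff_subsingleton.2 this).trans Nat.card_pos

/-- Functionals on a module are bounded in number by those on a submodule and its quotient. -/
theorem Submodule.natCard_dual_le_mul {R : Type*} [CommRing R] [Finite R]
    {M : Type*} [AddCommGroup M] [Module R M] [Finite M] (N : Submodule R M) :
    Nat.card (M →ₗ[R] R) ≤ Nat.card (N →ₗ[R] R) * Nat.card ((M ⧸ N) →ₗ[R] R) := by
  have hfin (P : Type _) [AddCommGroup P] [Module R P] [Finite P] : Finite (P →ₗ[R] R) :=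
    DFunLike.finite _
  have := hfin M
  have := hfin N
  have : Finite (M ⧸ N) := Finite.of_surjective _ N.mkQ_surjective
  have := hfin (M ⧸ N)
  let φ : (M →ₗ[R] R) →ₗ[R] (N →ₗ[R] R) := LinearMap.lcomp R R N.subtype
  rw [Submodule.natCard_eq_mul_quotient (LinearMap.ker φ), mul_comm]
  refine Nat.mul_le_mul ?_ ?_
  · exact Nat.card_le_card_of_injective _
      (LinearMap.ker_eq_bot.1 ((LinearMap.ker φ).ker_liftQ_eq_bot _ le_rfl le_rfl))
  · refine Nat.card_le_card_of_injective
      (fun f : LinearMap.ker φ => N.liftQ f.1 fun x hx => LinearMap.congr_fun f.2 ⟨x, hx⟩)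
      fun f g hfg => ?_
    ext x
    exact LinearMap.congr_fun hfg (N.mkQ x)

/-- A finite module over a finite self-injective commutative ring has at most as many
functionals as elements. -/
theorem Module.natCard_dual_le_of_injective {R : Type*} [CommRing R] [Finite R]
    (hR : Module.Injective R R) (M : Type*) [AddCommGroup M] [Module R M] [Finite M] :
    Nat.card (M →ₗ[R] R) ≤ Nat.card M := by
  induction hn : Nat.card M using Nat.strong_induction_on generalizing M with
  | _ m ih =>
    subst hn
    rcases subsingleton_or_nontrivial M with hM | hM
    · have : Subsingleton (M →ₗ[R] R) := inferInstance
      exact (Finite.card_le_one_iff_subsingleton.2 this).trans Nat.card_pos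
    by_cases hs : IsSimpleModule R M
    · exact IsSimpleModule.natCard_dual_le hR
    obtain ⟨N, hN0, hN1⟩ : ∃ N : Submodule R M, N ≠ ⊥ ∧ N ≠ ⊤ := by
      by_contra! h
      exact hs ((isSimpleModule_iff R M).2 ⟨fun N => or_iff_not_imp_left.2 (h N)⟩)
    have hcard := Submodule.natCard_eq_mul_quotient N
    have := (Submodule.nontrivial_iff_ne_bot).2 hN0
    have := Submodule.Quotient.nontrivial_iff.2 hN1
    have : Finite (M ⧸ N) := _root_.Finite.of_surjective _ N.mkQ_surjective
    have h1 : 1 < Nat.card N := Finite.one_lt_card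
    have h2 : 1 < Nat.card (M ⧸ N) := Finite.one_lt_card
    calc Nat.card (M →ₗ[R] R)
        ≤ Nat.card (N →ₗ[R] R) * Nat.card ((M ⧸ N) →ₗ[R] R) := N.natCard_dual_le_mul
      _ ≤ Nat.card N * Nat.card (M ⧸ N) :=
        Nat.mul_le_mul (ih _ (by nlinarith) N rfl) (ih _ (by nlinarith) (M ⧸ N) rfl)
      _ = Nat.card M := hcard.symm

/-- **Wood's identity** `|C| * |C^⊥| = |R| ^ n`. -/
theorem natCard_mul_natCard_dualCode {R : Type*} [CommRing R] [Finite R]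
    (hR : Module.Injective R R) {n : ℕ} (C : Submodule R (Fin n → R)) :
    Nat.card C * Nat.card (dualCode C) = Nat.card R ^ n := by
  let φ : (Fin n → R) →ₗ[R] (C →ₗ[R] R) :=
    LinearMap.lcomp R R C.subtype ∘ₗ (dotProductEquiv R (Fin n)).toLinearMap
  have hker : LinearMap.ker φ = dualCode C := by
    ext u
    exact ⟨fun h c hc => LinearMap.congr_fun h ⟨c, hc⟩, fun h => LinearMap.ext fun c => h c c.2⟩
  have hsurj : Function.Surjective φ := fun g => by
    obtain ⟨h, hh⟩ :=
      (Module.Baer.of_injective hR).extension_property C.subtype C.injective_subtype g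
    exact ⟨(dotProductEquiv R (Fin n)).symm h,
      (congrArg (LinearMap.lcomp R R C.subtype) (LinearEquiv.apply_symm_apply _ h)).trans hh⟩
  have hpow : Nat.card (Fin n → R) = Nat.card R ^ n := by simp [Nat.card_fun]
  have hdual : Nat.card (Fin n → R) = Nat.card (dualCode C) * Nat.card (C →ₗ[R] R) := by
    rw [Submodule.natCard_eq_mul_quotient (LinearMap.ker φ),
      Nat.card_congr (φ.quotKerEquivOfSurjective hsurj).toEquiv, hker]
  have hquot : Nat.card (dualCode C) ≤ Nat.card ((Fin n → R) ⧸ C) := by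
    have : Finite ((Fin n → R) ⧸ C) := Finite.of_surjective _ C.mkQ_surjective
    have : Finite (((Fin n → R) ⧸ C) →ₗ[R] R) := DFunLike.finite _
    refine (Nat.card_le_card_of_injective
      (fun u : dualCode C => C.liftQ (dotProductEquiv R (Fin n) u.1) fun x hx => u.2 x hx)
      fun u v huv => ?_).trans (Module.natCard_dual_le_of_injective hR _)
    refine Subtype.ext ((dotProductEquiv R (Fin n)).injective (LinearMap.ext fun x => ?_))
    exact LinearMap.congr_fun huv (C.mkQ x)
  rw [← hpow]
  apply le_antisymm
  · rw [Submodule.natCard_eq_mul_quotient C]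
    exact Nat.mul_le_mul_left _ hquot
  · rw [hdual, mul_comm]
    exact Nat.mul_le_mul_right _ (Module.natCard_dual_le_of_injective hR C)

theorem dim_add_dim_dual
    (R : Type*) [CommRing R] [Fintype R]
    (hFrob : Module.Injective R R)
    (q ω n : ℕ) (hq : IsPrimePow q) (hω : Nat.card R = q ^ ω)
    (C : Submodule R (Fin n → R)) :
    Real.logb q (Nat.card C) + Real.logb q (Nat.card (dualCode C)) =
      (n : ℝ) * ω := by
  have hq1 : (1 : ℝ) < q := by exact_mod_cast hq.one_lt
  rw [← Real.logb_mul (by exact_mod_cast Nat.card_pos.ne') (by exact_mod_cast Nat.card_pos.ne'),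
    ← Nat.cast_mul, natCard_mul_natCard_dualCode hFrob, hω, Nat.cast_pow, Nat.cast_pow,
    Real.logb_pow, Real.logb_pow, Real.logb_self_eq_one hq1, mul_one]
end

section
/- Let R = CRT(R_1,…,R_u) be a finite commutative ring decomposed as a product of finite local rings via the Chinese Remainder Theorem, and let C = CRT(C_1,…,C_u) be a linear code of length n over R with components C_j over R_j. Then |C| = ∏_{j=1}^u |C_j|, and C is a free R-module if and only if each C_j is a free R_j-module and all C_j have the same rank. -/
/-- The minimal number of generators of a module. -/
noncomputable def minGen (R M : Type*) [CommRing R] [AddCommGroup M] [Module R M] : ℕ :=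
  sInf {m : ℕ | ∃ s : Finset M, s.card = m ∧ Submodule.span R (s : Set M) = ⊤}

section

variable {ι : Type*} [Fintype ι] [DecidableEq ι] (R : ι → Type*)
  [∀ j, CommRing (R j)] {n : ℕ}

instance (j : ι) : RingHomSurjective (Pi.evalRingHom R j) :=
  ⟨fun x => ⟨Pi.single j x, Pi.single_eq_same j x⟩⟩

/-- The `j`-th component projection of `(Π j, R j)ⁿ`, semilinear over evaluation. -/
def componentProj (j : ι) :
    (Fin n → ∀ j, R j) →ₛₗ[Pi.evalRingHom R j] (Fin n → R j) where
  toFun x := fun i => x i j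
  map_add' _ _ := rfl
  map_smul' _ _ := rfl

/-- The `j`-th component code of a code over a product ring. -/
def componentCode (C : Submodule (∀ j, R j) (Fin n → ∀ j, R j)) (j : ι) :
    Submodule (R j) (Fin n → R j) :=
  Submodule.map (componentProj R j) C

theorem minGen_eq_finrank (R M : Type*) [CommRing R] [Nontrivial R] [AddCommGroup M]
    [Module R M] [Module.Free R M] [Module.Finite R M] :
    minGen R M = Module.finrank R M := by
  classical
  apply le_antisymm
  · refine Nat.sInf_le ⟨Finset.univ.image (Module.finBasis R M), ?_, ?_⟩
    · rw [Finset.card_image_of_injective _ (Module.finBasis R M).injective, Finset.card_fin]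
    · simp
  · obtain ⟨s, hs⟩ := Module.Finite.fg_top (R := R) (M := M)
    refine le_csInf ⟨s.card, s, rfl, hs⟩ ?_
    rintro m ⟨t, rfl, ht⟩
    have h := finrank_span_finset_le_card (R := R) t
    rwa [Set.finrank, ht, finrank_top] at h

section

variable {ι : Type*} [DecidableEq ι] {R : ι → Type*}
  [∀ j, CommRing (R j)] {n : ℕ} (C : Submodule (∀ j, R j) (Fin n → ∀ j, R j))

/-- The projection of a code onto one of its components. -/
def toComponentCode (j : ι) : C →ₛₗ[Pi.evalRingHom R j] componentCode R C j where
  toFun c := ⟨componentProj R j c, Submodule.mem_map_of_mem c.2⟩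
  map_add' _ _ := rfl
  map_smul' _ _ := rfl

@[simp]
theorem toComponentCode_apply (j : ι) (c : C) (k : Fin n) :
    (toComponentCode C j c : Fin n → R j) k = (c : Fin n → ∀ j, R j) k j :=
  rfl

theorem toComponentCode_surjective (j : ι) : Function.Surjective (toComponentCode C j) := by
  rintro ⟨_, c, hc, rfl⟩
  exact ⟨⟨c, hc⟩, rfl⟩

theorem mem_of_forall_mem_componentCode [Fintype ι] {x : Fin n → ∀ j, R j}
    (hx : ∀ j, (fun k => x k j) ∈ componentCode R C j) : x ∈ C := by
  choose c hc h using hx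
  have hsum : x = ∑ j, (Pi.single j 1 : ∀ j, R j) • c j := by
    ext k j
    have hk : c j k j = x k j := congrFun (h j) k
    rw [Finset.sum_apply, Finset.sum_apply, Finset.sum_eq_single j]
    · simp [hk]
    · intro i _ hij
      simp [Pi.single_eq_of_ne' hij]
    · simp
  rw [hsum]
  exact C.sum_mem fun j _ => C.smul_mem _ (hc j)

/-- A code over a product ring is the product of its components. -/
def codeEquivPi [Fintype ι] : C ≃ ∀ j, componentCode R C j where
  toFun c j := toComponentCode C j c
  invFun y := ⟨fun k j => (y j : Fin n → R j) k,
    mem_of_forall_mem_componentCode C fun j => (y j).2⟩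
  left_inv _ := rfl
  right_inv _ := rfl

/-- Bases of the components indexed by the same finite type make the code free. -/
noncomputable def codeEquivFun [Fintype ι] {κ : Type*} [Fintype κ]
    (b : ∀ j, Module.Basis κ (R j) (componentCode R C j)) :
    C ≃ₗ[∀ j, R j] (κ → ∀ j, R j) where
  toFun c i j := (b j).equivFun (toComponentCode C j c) i
  invFun f := (codeEquivPi C).symm fun j => (b j).equivFun.symm fun i => f i j
  left_inv c := by
    rw [Equiv.symm_apply_eq]
    ext1 j
    exact (b j).equivFun.symm_apply_apply _
  right_inv f := by
    ext i j
    exact congrFun ((b j).equivFun.apply_symm_apply fun i => f i j) i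
  map_add' x y := by
    ext i j
    simp
  map_smul' a x := by
    ext i j
    simp

/-- A basis of the code projects to a basis of each component. -/
noncomputable def componentBasis {κ : Type*} [Fintype κ]
    (b : Module.Basis κ (∀ j, R j) C) (j : ι) :
    Module.Basis κ (R j) (componentCode R C j) := by
  refine Module.Basis.mk (v := fun i => toComponentCode C j (b i)) ?_ ?_
  · rw [Fintype.linearIndependent_iff]
    intro a ha i
    have h : ∑ i, (Pi.single j (a i) : ∀ j, R j) • b i = 0 := by
      ext k l
      by_cases hl : l = j
      · subst hl
        have := congrFun (congrArg Subtype.val ha) k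
        simpa using this
      · simp [Pi.single_eq_of_ne hl]
    simpa using congrFun (Fintype.linearIndependent_iff.mp b.linearIndependent _ h i) j
  · rintro y -
    obtain ⟨c, rfl⟩ := toComponentCode_surjective C j y
    rw [← b.sum_repr c, map_sum]
    refine Submodule.sum_mem _ fun i _ => ?_
    rw [LinearMap.map_smulₛₗ]
    exact Submodule.smul_mem _ _ (Submodule.subset_span ⟨i, rfl⟩)

end

theorem crt_code_card_and_free
    (ι : Type*) [Fintype ι] [DecidableEq ι] (R : ι → Type*)
    [∀ j, CommRing (R j)] [∀ j, Fintype (R j)] [∀ j, IsLocalRing (R j)]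
    (n : ℕ) (C : Submodule (∀ j, R j) (Fin n → ∀ j, R j)) :
    Nat.card C = ∏ j, Nat.card ↥(componentCode R C j) ∧
    (Module.Free (∀ j, R j) C ↔
      ((∀ j, Module.Free (R j) ↥(componentCode R C j)) ∧
        ∀ j, minGen (R j) ↥(componentCode R C j) = minGen (∀ j, R j) C)) := by
  refine ⟨(Nat.card_congr (codeEquivPi C)).trans Nat.card_pi, fun _ => ?_, ?_⟩
  · have hfree (j : ι) : Module.Free (R j) (componentCode R C j) := by
      have := Pi.nontrivial_at (f := R) j
      exact .of_basis (componentBasis C (Module.finBasis (∀ j, R j) C) j)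
    refine ⟨hfree, fun j => ?_⟩
    have := Pi.nontrivial_at (f := R) j
    rw [minGen_eq_finrank, minGen_eq_finrank,
      Module.finrank_eq_card_basis (componentBasis C (Module.finBasis (∀ j, R j) C) j),
      Fintype.card_fin]
  · rintro ⟨_, hrank⟩
    have hfinrank (j : ι) :
        Module.finrank (R j) (componentCode R C j) = minGen (∀ j, R j) C := by
      rw [← hrank j, minGen_eq_finrank]
    exact .of_equiv
      (codeEquivFun C fun j => Module.finBasisOfFinrankEq _ _ (hfinrank j)).symm

end
end
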